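/- (Corollary 3) Let A(p), A(p+1), …, A(q) (q ≥ p) be real n×n matrices. Suppose the union of their signed digraphs is strongly connected and the sequence is jointly structurally unbalanced. Then the union of the digraphs Γ(Ā(p)), …, Γ(Ā(q)) of the expanded matrices (on the 2n vertices Fin n ⊕ Fin n) is strongly connected. -/

import Mathlib

/-- The expanded (lifted) nonnegative matrix `Ā` of `A`, indexed by `Fin n ⊕ Fin n`. -/
def expand {n : ℕ} (A : Matrix (Fin n) (Fin n) ℝ) :
    Matrix (Fin n ⊕ Fin n) (Fin n ⊕ Fin n) ℝ :=
  Matrix.of fun u v =>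
    match u, v with
    | Sum.inl i, Sum.inl j => max (A i j) 0
    | Sum.inl i, Sum.inr j => max (-(A i j)) 0
    | Sum.inr i, Sum.inl j => max (-(A i j)) 0
    | Sum.inr i, Sum.inr j => max (A i j) 0

/-- Arc relation of the union of the signed digraphs `Γ(A p), …, Γ(A q)`:
an arc from `i` to `j` whenever `A t j i ≠ 0` for some `t ∈ {p, …, q}`. -/
def unionArc {n : ℕ} (A : ℕ → Matrix (Fin n) (Fin n) ℝ) (p q : ℕ) (i j : Fin n) : Prop :=
  ∃ t : ℕ, p ≤ t ∧ t ≤ q ∧ A t j i ≠ 0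

/-- Arc relation of the union of the expanded digraphs `Γ(Ā p), …, Γ(Ā q)`:
an arc from `u` to `v` whenever `Ā(t) v u ≠ 0` for some `t ∈ {p, …, q}`. -/
def unionBarArc {n : ℕ} (A : ℕ → Matrix (Fin n) (Fin n) ℝ) (p q : ℕ)
    (u v : Fin n ⊕ Fin n) : Prop :=
  ∃ t : ℕ, p ≤ t ∧ t ≤ q ∧ expand (A t) v u ≠ 0

/-- The expanded union graph is invariant under exchanging the two copies of the vertex set. -/
theorem unionBarArc.swap {n : ℕ} {A : ℕ → Matrix (Fin n) (Fin n) ℝ} {p q : ℕ}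
    {u v : Fin n ⊕ Fin n} (h : unionBarArc A p q u v) : unionBarArc A p q u.swap v.swap := by
  obtain ⟨t, hp, hq, h⟩ := h
  refine ⟨t, hp, hq, ?_⟩
  rcases u with i | i <;> rcases v with j | j <;> exact h

/-- Reachability in the expanded union graph is invariant under exchanging the two copies. -/
theorem reflTransGen_unionBarArc_swap {n : ℕ} {A : ℕ → Matrix (Fin n) (Fin n) ℝ} {p q : ℕ}
    {u v : Fin n ⊕ Fin n} (h : Relation.ReflTransGen (unionBarArc A p q) u v) :
    Relation.ReflTransGen (unionBarArc A p q) u.swap v.swap :=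
  h.lift Sum.swap fun _ _ => unionBarArc.swap

/-- A positive arc lifts to an arc between the first copies of its endpoints. -/
theorem unionBarArc_inl_inl {n : ℕ} {A : ℕ → Matrix (Fin n) (Fin n) ℝ} {p q t : ℕ}
    (hp : p ≤ t) (hq : t ≤ q) {i j : Fin n} (h : 0 < A t j i) :
    unionBarArc A p q (Sum.inl i) (Sum.inl j) :=
  ⟨t, hp, hq, (lt_max_of_lt_left h).ne'⟩

/-- A negative arc lifts to an arc from the first copy of its tail to the second copy of its
head. -/
theorem unionBarArc_inl_inr {n : ℕ} {A : ℕ → Matrix (Fin n) (Fin n) ℝ} {p q t : ℕ}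
    (hp : p ≤ t) (hq : t ≤ q) {i j : Fin n} (h : A t j i < 0) :
    unionBarArc A p q (Sum.inl i) (Sum.inr j) :=
  ⟨t, hp, hq, (lt_max_of_lt_left (neg_pos.mpr h)).ne'⟩

/-- A walk from `i` to `j` lifts to a walk from the first copy of `i` to some copy of `j`. -/
theorem reflTransGen_unionBarArc_inl_or_inr {n : ℕ} {A : ℕ → Matrix (Fin n) (Fin n) ℝ}
    {p q : ℕ} {i j : Fin n} (h : Relation.ReflTransGen (unionArc A p q) i j) :
    Relation.ReflTransGen (unionBarArc A p q) (Sum.inl i) (Sum.inl j) ∨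
      Relation.ReflTransGen (unionBarArc A p q) (Sum.inl i) (Sum.inr j) := by
  induction h with
  | refl => exact Or.inl .refl
  | tail _ h ih =>
    obtain ⟨t, hp, hq, h⟩ := h
    rcases h.lt_or_gt with h | h <;> rcases ih with ih | ih
    · exact Or.inr (ih.tail (unionBarArc_inl_inr hp hq h))
    · exact Or.inl (ih.tail (unionBarArc_inl_inr hp hq h).swap)
    · exact Or.inl (ih.tail (unionBarArc_inl_inl hp hq h))
    · exact Or.inr (ih.tail (unionBarArc_inl_inl hp hq h).swap)

/-- If the union graph is strongly connected and some vertex cannot reach its own second copy in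
the expanded graph, then the sequence is jointly structurally balanced. -/
theorem exists_balancing_of_not_reflTransGen_inl_inr {n : ℕ}
    {A : ℕ → Matrix (Fin n) (Fin n) ℝ} {p q : ℕ}
    (hsc : ∀ i j : Fin n, Relation.ReflTransGen (unionArc A p q) i j) {k : Fin n}
    (hk : ¬ Relation.ReflTransGen (unionBarArc A p q) (Sum.inl k) (Sum.inr k)) :
    ∃ b : Fin n → ℝ, (∀ i, b i = 1 ∨ b i = -1) ∧
      ∀ t : ℕ, p ≤ t → t ≤ q → ∀ i j : Fin n,
        (0 < A t j i → b i = b j) ∧ (A t j i < 0 → b i = -b j) := by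
  classical
  let R := Relation.ReflTransGen (unionBarArc A p q)
  have not_both (j : Fin n) (hl : R (Sum.inl k) (Sum.inl j)) : ¬ R (Sum.inl k) (Sum.inr j) := by
    intro hr
    rcases reflTransGen_unionBarArc_inl_or_inr (hsc j k) with h | h
    · exact hk (hr.trans (reflTransGen_unionBarArc_swap h))
    · exact hk (hl.trans h)
  have reach_inr (j : Fin n) (hl : ¬ R (Sum.inl k) (Sum.inl j)) : R (Sum.inl k) (Sum.inr j) :=
    (reflTransGen_unionBarArc_inl_or_inr (hsc k j)).resolve_left hl
  refine ⟨fun j => if R (Sum.inl k) (Sum.inl j) then 1 else -1,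
    fun i => by dsimp only; split_ifs <;> simp, fun t hp hq i j => ⟨fun h => ?_, fun h => ?_⟩⟩
  · have arc := unionBarArc_inl_inl hp hq h
    by_cases hi : R (Sum.inl k) (Sum.inl i)
    · have hj : R (Sum.inl k) (Sum.inl j) := hi.tail arc
      simp [hi, hj]
    · have hj : ¬ R (Sum.inl k) (Sum.inl j) :=
        fun hj => not_both j hj ((reach_inr i hi).tail arc.swap)
      simp [hi, hj]
  · have arc := unionBarArc_inl_inr hp hq h
    by_cases hi : R (Sum.inl k) (Sum.inl i)
    · have hj : ¬ R (Sum.inl k) (Sum.inl j) := fun hj => not_both j hj (hi.tail arc)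
      simp [hi, hj]
    · have hj : R (Sum.inl k) (Sum.inl j) := (reach_inr i hi).tail arc.swap
      simp [hi, hj]


/-- Corollary 3: if the union of the signed digraphs of `A p, …, A q` is strongly
connected and the sequence is jointly structurally unbalanced, then the union of the
expanded digraphs `Γ(Ā p), …, Γ(Ā q)` is strongly connected. -/
theorem union_expanded_graph_of_jointly_unbalanced_strongly_connected {n : ℕ}
    (A : ℕ → Matrix (Fin n) (Fin n) ℝ) (p q : ℕ) (hpq : p ≤ q)
    (hsc : ∀ i j : Fin n, Relation.ReflTransGen (unionArc A p q) i j)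
    (hunbal : ¬ ∃ b : Fin n → ℝ, (∀ i, b i = 1 ∨ b i = -1) ∧
      ∀ t : ℕ, p ≤ t → t ≤ q → ∀ i j : Fin n,
        (0 < A t j i → b i = b j) ∧ (A t j i < 0 → b i = -b j)) :
    ∀ u v : Fin n ⊕ Fin n, Relation.ReflTransGen (unionBarArc A p q) u v := by
  have hlr (i : Fin n) : Relation.ReflTransGen (unionBarArc A p q) (Sum.inl i) (Sum.inr i) := by
    by_contra h
    exact hunbal (exists_balancing_of_not_reflTransGen_inl_inr hsc h)
  have hll (i j : Fin n) : Relation.ReflTransGen (unionBarArc A p q) (Sum.inl i) (Sum.inl j) :=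
    (reflTransGen_unionBarArc_inl_or_inr (hsc i j)).elim id
      fun h => h.trans (reflTransGen_unionBarArc_swap (hlr j))
  rintro (i | i) (j | j)
  · exact hll i j
  · exact (hll i j).trans (hlr j)
  · exact (reflTransGen_unionBarArc_swap (hlr i)).trans (hll i j)
  · exact reflTransGen_unionBarArc_swap (hll i j)
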